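/- Let μ be a unit pure quaternion and U ∈ ℍ^{n×n×n₃}. Then U is a unitary tensor if and only if every frontal slice of fft(U) is a unitary quaternion matrix (equivalently, diag(fft(U)) is a unitary matrix). -/

import Mathlib

noncomputable section
open Matrix Kronecker Filter Topology

namespace QTpaper

/-- The quaternion unit `i`. -/
def qi : Quaternion ℝ := ⟨0, 1, 0, 0⟩
/-- The quaternion unit `j`. -/
def qj : Quaternion ℝ := ⟨0, 0, 1, 0⟩
/-- The quaternion unit `k`. -/
def qk : Quaternion ℝ := ⟨0, 0, 0, 1⟩

/-- A unit pure quaternion: zero real part and norm one. -/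
def UnitPure (μ : Quaternion ℝ) : Prop := μ.re = 0 ∧ ‖μ‖ = 1

/-- Third-order quaternion tensors. -/
abbrev QTensor (a b c : ℕ) := Fin a → Fin b → Fin c → Quaternion ℝ

/-- `l`-th frontal slice of a third-order tensor. -/
def fslice {a b c : ℕ} (A : QTensor a b c) (l : Fin c) :
    Matrix (Fin a) (Fin b) (Quaternion ℝ) := fun p q => A p q l

/-- Frobenius norm of a quaternion matrix. -/
def frobM {m n : ℕ} (A : Matrix (Fin m) (Fin n) (Quaternion ℝ)) : ℝ :=
  Real.sqrt (∑ p, ∑ q, ‖A p q‖ ^ 2)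

/-- Frobenius norm of a third-order quaternion tensor. -/
def frobT {a b c : ℕ} (A : QTensor a b c) : ℝ :=
  Real.sqrt (∑ p, ∑ q, ∑ l, ‖A p q l‖ ^ 2)

/-- The normalized QDFT matrix `F_{μ,n}` with entries
`(1/√n)·ω^{(p-1)(q-1)}`, `ω^m = cos(2πm/n) − μ·sin(2πm/n)`. -/
def Fq (μ : Quaternion ℝ) (n : ℕ) : Matrix (Fin n) (Fin n) (Quaternion ℝ) :=
  fun p q =>
    ((1 / Real.sqrt n : ℝ) : Quaternion ℝ) *
      (((Real.cos (2 * Real.pi * (p.1 * q.1) / n) : ℝ) : Quaternion ℝ)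
        - ((Real.sin (2 * Real.pi * (p.1 * q.1) / n) : ℝ) : Quaternion ℝ) * μ)

/-- The permutation matrix `P_n` (1-based: `P₁₁ = 1`, `P_{pq} = 1` for `p+q = n+2`). -/
def Pmat (n : ℕ) : Matrix (Fin n) (Fin n) ℝ :=
  fun p q => if (p.1 = 0 ∧ q.1 = 0) ∨ (p.1 + q.1 = n) then 1 else 0

/-- Block circulant matrix of a third-order tensor. -/
def circ {a b c : ℕ} (A : QTensor a b c) :
    Matrix (Fin c × Fin a) (Fin c × Fin b) (Quaternion ℝ) :=
  fun pi qj => A pi.2 qj.2 (pi.1 - qj.1)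

/-- `unfold` stacks the frontal slices vertically. -/
def unfold3 {a b c : ℕ} (A : QTensor a b c) :
    Matrix (Fin c × Fin a) (Fin b) (Quaternion ℝ) :=
  fun pi q => A pi.2 q pi.1

/-- `fold` is the inverse of `unfold`. -/
def fold3 {a b c : ℕ} (M : Matrix (Fin c × Fin a) (Fin b) (Quaternion ℝ)) :
    QTensor a b c := fun p q l => M (l, p) q

/-- Block diagonal matrix whose `l`-th diagonal block is the `l`-th frontal slice. -/
def diagT {a b c : ℕ} (A : QTensor a b c) :
    Matrix (Fin c × Fin a) (Fin c × Fin b) (Quaternion ℝ) :=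
  fun pi qj => if pi.1 = qj.1 then A pi.2 qj.2 pi.1 else 0

/-- The QDFT along mode 3: `fft(A)(p,q,:) = √n₃ · F_{μ,n₃} · A(p,q,:)`. -/
def fftT {a b c : ℕ} (μ : Quaternion ℝ) (A : QTensor a b c) : QTensor a b c :=
  fun p q l => ((Real.sqrt c : ℝ) : Quaternion ℝ) * ∑ m, Fq μ c l m * A p q m

/-- Real-part component tensor. -/
def compE {a b c : ℕ} (A : QTensor a b c) : QTensor a b c :=
  fun p q l => (((A p q l).re : ℝ) : Quaternion ℝ)
/-- `i`-component tensor. -/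
def compI {a b c : ℕ} (A : QTensor a b c) : QTensor a b c :=
  fun p q l => (((A p q l).imI : ℝ) : Quaternion ℝ)
/-- `j`-component tensor. -/
def compJ {a b c : ℕ} (A : QTensor a b c) : QTensor a b c :=
  fun p q l => (((A p q l).imJ : ℝ) : Quaternion ℝ)
/-- `k`-component tensor. -/
def compK {a b c : ℕ} (A : QTensor a b c) : QTensor a b c :=
  fun p q l => (((A p q l).imK : ℝ) : Quaternion ℝ)

/-- For `μ = a·i + b·j + c·k`, `μ_i = a·i − b·j − c·k`. -/
def mui (μ : Quaternion ℝ) : Quaternion ℝ := ⟨0, μ.imI, -μ.imJ, -μ.imK⟩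
/-- For `μ = a·i + b·j + c·k`, `μ_j = −a·i + b·j − c·k`. -/
def muj (μ : Quaternion ℝ) : Quaternion ℝ := ⟨0, -μ.imI, μ.imJ, -μ.imK⟩
/-- For `μ = a·i + b·j + c·k`, `μ_k = −a·i − b·j + c·k`. -/
def muk (μ : Quaternion ℝ) : Quaternion ℝ := ⟨0, -μ.imI, -μ.imJ, μ.imK⟩

/-- `T` matrix `F_{ν,n}^* · F_{μ,n}`. -/
def Tm (ν μ : Quaternion ℝ) (n : ℕ) : Matrix (Fin n) (Fin n) (Quaternion ℝ) :=
  (Fq ν n)ᴴ * Fq μ n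

/-- The gQt-product of third-order quaternion tensors. -/
def gQt {n₁ r n₂ n₃ : ℕ} (μ : Quaternion ℝ) (A : QTensor n₁ r n₃)
    (B : QTensor r n₂ n₃) : QTensor n₁ n₂ n₃ :=
  fold3 ((circ (compE A)
      + qi • (circ (compI A) * (Tm (mui μ) μ n₃ ⊗ₖ (1 : Matrix (Fin r) (Fin r) (Quaternion ℝ))))
      + qj • (circ (compJ A) * (Tm (muj μ) μ n₃ ⊗ₖ (1 : Matrix (Fin r) (Fin r) (Quaternion ℝ))))
      + qk • (circ (compK A) * (Tm (muk μ) μ n₃ ⊗ₖ (1 : Matrix (Fin r) (Fin r) (Quaternion ℝ)))))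
    * unfold3 B)

/-- The index reversal `1 ↦ 1`, `l ↦ n₃ + 2 − l` (1-based), used in the tensor transpose. -/
def revIdx {c : ℕ} (l : Fin c) : Fin c :=
  if h : l.1 = 0 then l else ⟨c - l.1, by have := l.2; omega⟩

/-- Transpose of a (componentwise real) tensor: transpose each frontal slice and
reverse the order of the transposed slices `2` through `n₃`. -/
def transT {a b c : ℕ} (A : QTensor a b c) : QTensor b a c :=
  fun q p l => A p q (revIdx l)

/-- Right multiplication of a matrix by a quaternion scalar. -/
def rmulM {m n : Type*} (M : Matrix m n (Quaternion ℝ)) (x : Quaternion ℝ) :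
    Matrix m n (Quaternion ℝ) := fun p q => M p q * x

/-- Conjugate transpose of a third-order quaternion tensor. -/
def conjT {n₁ n₂ n₃ : ℕ} (μ : Quaternion ℝ) (A : QTensor n₁ n₂ n₃) : QTensor n₂ n₁ n₃ :=
  fold3 (unfold3 (transT (compE A))
    - rmulM (((Tm (mui μ) μ n₃)ᴴ ⊗ₖ (1 : Matrix (Fin n₂) (Fin n₂) (Quaternion ℝ)))
        * unfold3 (transT (compI A))) qi
    - rmulM (((Tm (muj μ) μ n₃)ᴴ ⊗ₖ (1 : Matrix (Fin n₂) (Fin n₂) (Quaternion ℝ)))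
        * unfold3 (transT (compJ A))) qj
    - rmulM (((Tm (muk μ) μ n₃)ᴴ ⊗ₖ (1 : Matrix (Fin n₂) (Fin n₂) (Quaternion ℝ)))
        * unfold3 (transT (compK A))) qk)

/-- The identity tensor: first frontal slice is the identity, the others vanish. -/
def idT (n l : ℕ) : QTensor n n l :=
  fun p q m => if m.1 = 0 ∧ p = q then 1 else 0

/-- Unitary tensor with respect to the gQt-product. -/
def unitaryT {n n₃ : ℕ} (μ : Quaternion ℝ) (U : QTensor n n n₃) : Prop :=
  gQt μ (conjT μ U) U = idT n n₃ ∧ gQt μ U (conjT μ U) = idT n n₃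

/-- f-diagonal tensor: each frontal slice is a diagonal matrix. -/
def fDiag {a b c : ℕ} (S : QTensor a b c) : Prop :=
  ∀ p q l, p.1 ≠ q.1 → S p q l = 0

/-- The real algebra embedding of `ℂ` into the quaternions sending `I` to `-ν`. -/
def complexEmb (ν : Quaternion ℝ) (hν : ν * ν = -1) : ℂ →ₐ[ℝ] Quaternion ℝ :=
  Complex.liftAux (-ν) (by rw [neg_mul_neg, hν])

/-- The standard primitive `c`-th root of unity. -/
def zeta (c : ℕ) : ℂ := Complex.exp (2 * Real.pi * Complex.I / c)

theorem zeta_pow (c m : ℕ) :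
    zeta c ^ m = Real.cos (2 * Real.pi * m / c) + Real.sin (2 * Real.pi * m / c) * Complex.I := by
  rw [zeta, ← Complex.exp_nat_mul, Complex.ofReal_cos, Complex.ofReal_sin, ← Complex.exp_mul_I]
  congr 1
  push_cast
  ring

theorem Fq_apply {ν : Quaternion ℝ} (hν : ν * ν = -1) {c : ℕ} (p q : Fin c) :
    Fq ν c p q = (1 / Real.sqrt c) • complexEmb ν hν (zeta c ^ (p.1 * q.1)) := by
  rw [zeta_pow, Fq, Quaternion.coe_mul_eq_smul]
  simp [complexEmb, Complex.liftAux_apply, Quaternion.coe_mul_eq_smul, sub_eq_add_neg,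
    -Complex.ofReal_cos, -Complex.ofReal_sin]

theorem star_complexEmb {ν : Quaternion ℝ} (hν : ν * ν = -1) (h : star ν = -ν) (z : ℂ) :
    star (complexEmb ν hν z) = complexEmb ν hν (star z) := by
  simp [complexEmb, Complex.liftAux_apply, h]

theorem zeta_pow_self (c : ℕ) [NeZero c] : zeta c ^ c = 1 :=
  (Complex.isPrimitiveRoot_exp c (NeZero.ne c)).pow_eq_one

theorem zeta_mul_star (c : ℕ) : zeta c * star (zeta c) = 1 := by
  rw [zeta, Complex.star_def, ← Complex.exp_conj, ← Complex.exp_add]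
  simp [neg_div, Complex.conj_ofNat]

theorem sum_zeta (c : ℕ) [NeZero c] (k l : Fin c) :
    ∑ m : Fin c, zeta c ^ (k.1 * m.1) * star (zeta c ^ (l.1 * m.1)) =
      if k = l then (c : ℂ) else 0 := by
  have h0 : zeta c ≠ 0 := Complex.exp_ne_zero _
  have hs : star (zeta c) = (zeta c)⁻¹ := eq_inv_of_mul_eq_one_right (zeta_mul_star c)
  have : ∀ m : Fin c, zeta c ^ (k.1 * m.1) * star (zeta c ^ (l.1 * m.1))
      = (zeta c ^ k.1 / zeta c ^ l.1) ^ m.1 := by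
    intro m
    rw [star_pow, hs, div_pow, ← pow_mul, ← pow_mul, inv_pow, div_eq_mul_inv]
  simp only [this]
  rw [Fin.sum_univ_eq_sum_range (fun m => (zeta c ^ k.1 / zeta c ^ l.1) ^ m)]
  split_ifs with h
  · subst h
    simp [h0]
  · rw [geom_sum_eq, div_pow, ← pow_mul, ← pow_mul, mul_comm k.1, mul_comm l.1, pow_mul, pow_mul,
      zeta_pow_self]
    · simp
    · intro h1
      rw [div_eq_one_iff_eq (pow_ne_zero _ h0)] at h1
      exact h (Fin.ext ((Complex.isPrimitiveRoot_exp c (NeZero.ne c)).pow_inj k.2 l.2 h1))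

theorem Fq_mul_conjTranspose {ν : Quaternion ℝ} (hν : ν * ν = -1) (h : star ν = -ν) (c : ℕ)
    [NeZero c] : Fq ν c * (Fq ν c)ᴴ = 1 := by
  ext1 k l
  have hc : (c : ℝ) ≠ 0 := NeZero.ne _
  simp only [Matrix.mul_apply, Matrix.conjTranspose_apply, Fq_apply hν, Quaternion.star_smul,
    star_complexEmb hν h, smul_mul_smul_comm, ← map_mul, ← Finset.smul_sum,
    ← map_sum, sum_zeta, Matrix.one_apply]
  split_ifs
  · have : Real.sqrt c * Real.sqrt c = c := Real.mul_self_sqrt (by positivity)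
    rw [← sq, div_pow, sq (Real.sqrt c), this, map_natCast]
    rw [← map_natCast (algebraMap ℝ (Quaternion ℝ)), Algebra.algebraMap_eq_smul_one, smul_smul,
      one_pow, one_div, inv_mul_cancel₀ hc, one_smul]
  · simp

theorem zeta_pow_mod (c m : ℕ) [NeZero c] : zeta c ^ (m % c) = zeta c ^ m :=
  (pow_eq_pow_mod m (zeta_pow_self c)).symm

theorem sqrt_mul_Fq_add {ν : Quaternion ℝ} (hν : ν * ν = -1) {c : ℕ} (k l m : Fin c) :
    Fq ν c k (l + m) = Real.sqrt c • (Fq ν c k l * Fq ν c k m) := by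
  have : NeZero c := ⟨by have := k.2; omega⟩
  have hc : Real.sqrt c ≠ 0 := (Real.sqrt_pos.2 (Nat.cast_pos.2 (NeZero.pos c))).ne'
  simp only [Fq_apply hν, smul_mul_smul_comm, smul_smul, ← map_mul]
  congr 1
  · field_simp
  · rw [Fin.val_add, mul_comm, pow_mul, zeta_pow_mod, ← pow_mul, mul_comm, mul_add, pow_add]

theorem star_Fq {ν : Quaternion ℝ} (hν : ν * ν = -1) (h : star ν = -ν) {c : ℕ} (k l : Fin c) :
    star (Fq ν c k l) = Fq ν c k (revIdx l) := by
  have : NeZero c := ⟨by have := k.2; omega⟩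
  have hz : zeta c ^ (revIdx l).1 * zeta c ^ l.1 = 1 := by
    rw [revIdx]
    split_ifs with hl
    · simp [hl]
    · rw [← pow_add, Nat.sub_add_cancel l.2.le, zeta_pow_self]
  have hs : star (zeta c) ^ l.1 = zeta c ^ (revIdx l).1 := by
    rw [← inv_eq_of_mul_eq_one_left hz, ← inv_pow, ← eq_inv_of_mul_eq_one_right (zeta_mul_star c)]
  simp only [Fq_apply hν, Quaternion.star_smul, star_complexEmb hν h, star_pow]
  rw [mul_comm, pow_mul, hs, ← pow_mul, mul_comm]

theorem Fq_mul_of_semiconj {μ ν e : Quaternion ℝ} (he : μ * e = e * ν) {c : ℕ} (k l : Fin c) :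
    Fq μ c k l * e = e * Fq ν c k l := by
  simp only [Fq, Quaternion.coe_mul_eq_smul, Quaternion.mul_coe_eq_smul, smul_mul_assoc,
    mul_smul_comm, sub_mul, mul_sub, he]

theorem conjTranspose_mul_Fq {ν : Quaternion ℝ} (hν : ν * ν = -1) (h : star ν = -ν) (c : ℕ)
    [NeZero c] : (Fq ν c)ᴴ * Fq ν c = 1 :=
  mul_eq_one_comm.mp (Fq_mul_conjTranspose hν h c)

theorem revIdx_involutive (c : ℕ) : Function.Involutive (revIdx (c := c)) := by
  intro l
  have := l.2
  ext
  simp only [revIdx]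
  split_ifs <;> simp_all
  all_goals omega

/-- Convolution theorem for a real sequence against a quaternion sequence. -/
theorem sum_Fq_conv {ν : Quaternion ℝ} (hν : ν * ν = -1) {c : ℕ} (k : Fin c) (a : Fin c → ℝ)
    (x : Fin c → Quaternion ℝ) :
    ∑ l, Fq ν c k l * ∑ m, (a (l - m) : Quaternion ℝ) * x m =
      Real.sqrt c • ((∑ l, Fq ν c k l * (a l : Quaternion ℝ)) * ∑ m, Fq ν c k m * x m) := by
  have : NeZero c := ⟨by have := k.2; omega⟩
  simp only [Finset.mul_sum, Finset.smul_sum]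
  rw [Finset.sum_comm]
  refine Finset.sum_congr rfl fun m _ => ?_
  rw [← Equiv.sum_comp (Equiv.addRight m), Finset.sum_mul, Finset.smul_sum]
  refine Finset.sum_congr rfl fun l _ => ?_
  rw [Equiv.coe_addRight, add_sub_cancel_right, sqrt_mul_Fq_add hν]
  simp only [Quaternion.coe_mul_eq_smul, Quaternion.mul_coe_eq_smul, smul_mul_assoc,
    mul_smul_comm, mul_assoc]
  rw [smul_comm]

theorem sum_Fq_conv_Tm {μ ν e : Quaternion ℝ} (he : μ * e = e * ν) (hν : ν * ν = -1)
    (h : star ν = -ν) {c : ℕ} (k : Fin c) (a : Fin c → ℝ) (b : Fin c → Quaternion ℝ) :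
    ∑ l, Fq μ c k l * (e * ∑ m, (a (l - m) : Quaternion ℝ) * ∑ s, Tm ν μ c m s * b s) =
      Real.sqrt c • ((∑ l, Fq μ c k l * (e * (a l : Quaternion ℝ))) * ∑ m, Fq μ c k m * b m) := by
  have : NeZero c := ⟨by have := k.2; omega⟩
  have hT : ∑ m, Fq ν c k m * ∑ s, Tm ν μ c m s * b s = ∑ m, Fq μ c k m * b m := by
    change (Fq ν c *ᵥ (Tm ν μ c *ᵥ b)) k = (Fq μ c *ᵥ b) k
    rw [Matrix.mulVec_mulVec, Tm, ← Matrix.mul_assoc, Fq_mul_conjTranspose hν h, Matrix.one_mul]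
  simp only [← mul_assoc, Fq_mul_of_semiconj he]
  simp only [mul_assoc e, ← Finset.mul_sum]
  rw [sum_Fq_conv hν, hT, mul_smul_comm]

theorem sum_Fq_conj_Tm {μ ν e : Quaternion ℝ} (he : μ * e = e * ν) (hμ : μ * μ = -1)
    (h' : star μ = -μ) (hν : ν * ν = -1) (h : star ν = -ν) (hs : star e = -e) {c : ℕ} (k : Fin c)
    (b : Fin c → ℝ) :
    ∑ l, Fq μ c k l * ((∑ s, (Tm ν μ c)ᴴ l s * (b (revIdx s) : Quaternion ℝ)) * e) =
      -star (∑ l, Fq μ c k l * (e * (b l : Quaternion ℝ))) := by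
  have : NeZero c := ⟨by have := k.2; omega⟩
  simp only [← mul_assoc, ← Finset.sum_mul, Fq_mul_of_semiconj he]
  have hT : ∑ m, Fq μ c k m * ∑ s, (Tm ν μ c)ᴴ m s * (b (revIdx s) : Quaternion ℝ)
      = ∑ m, Fq ν c k m * (b (revIdx m) : Quaternion ℝ) := by
    change (Fq μ c *ᵥ ((Tm ν μ c)ᴴ *ᵥ fun s => (b (revIdx s) : Quaternion ℝ))) k
      = (Fq ν c *ᵥ fun s => (b (revIdx s) : Quaternion ℝ)) k
    rw [Matrix.mulVec_mulVec, Tm, Matrix.conjTranspose_mul, Matrix.conjTranspose_conjTranspose,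
      ← Matrix.mul_assoc, Fq_mul_conjTranspose hμ h', Matrix.one_mul]
  rw [hT, ← Equiv.sum_comp (revIdx_involutive c).toPerm, star_sum, ← Finset.sum_neg_distrib,
    Finset.sum_mul]
  refine Finset.sum_congr rfl fun m _ => ?_
  simp only [Function.Involutive.coe_toPerm, (revIdx_involutive c) m, star_mul,
    Quaternion.star_smul, star_Fq hν h, hs,
    Quaternion.mul_coe_eq_smul, smul_mul_assoc, mul_neg, neg_neg, smul_neg]

theorem sum_Fq_rev {μ : Quaternion ℝ} (hμ : μ * μ = -1) (h : star μ = -μ) {c : ℕ} (k : Fin c)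
    (b : Fin c → ℝ) :
    ∑ l, Fq μ c k l * (b (revIdx l) : Quaternion ℝ) =
      star (∑ l, Fq μ c k l * (b l : Quaternion ℝ)) := by
  rw [← Equiv.sum_comp (revIdx_involutive c).toPerm, star_sum]
  refine Finset.sum_congr rfl fun m _ => ?_
  simp only [Function.Involutive.coe_toPerm, (revIdx_involutive c) m, Quaternion.star_smul,
    star_Fq hμ h, Quaternion.mul_coe_eq_smul]

theorem circ_mul_unfold3_apply {a r b c : ℕ} (A : QTensor a r c) (B : QTensor r b c) (l : Fin c)
    (p : Fin a) (q : Fin b) :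
    (circ A * unfold3 B) (l, p) q = ∑ t, ∑ m, A p t (l - m) * B t q m := by
  rw [Matrix.mul_apply, Fintype.sum_prod_type, Finset.sum_comm]
  rfl

theorem kronecker_one_mul_unfold3 {r b c : ℕ} (T : Matrix (Fin c) (Fin c) (Quaternion ℝ))
    (B : QTensor r b c) :
    (T ⊗ₖ (1 : Matrix (Fin r) (Fin r) (Quaternion ℝ))) * unfold3 B =
      unfold3 fun t q m => ∑ s, T m s * B t q s := by
  ext1 ⟨l, p⟩ q
  simp [Matrix.mul_apply, Fintype.sum_prod_type, unfold3, Matrix.one_apply]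

theorem gQt_apply {n₁ r n₂ n₃ : ℕ} (μ : Quaternion ℝ) (A : QTensor n₁ r n₃)
    (B : QTensor r n₂ n₃) (p : Fin n₁) (q : Fin n₂) (l : Fin n₃) :
    gQt μ A B p q l = ∑ t, ((∑ m, compE A p t (l - m) * B t q m)
      + qi * (∑ m, compI A p t (l - m) * ∑ s, Tm (mui μ) μ n₃ m s * B t q s)
      + qj * (∑ m, compJ A p t (l - m) * ∑ s, Tm (muj μ) μ n₃ m s * B t q s)
      + qk * (∑ m, compK A p t (l - m) * ∑ s, Tm (muk μ) μ n₃ m s * B t q s)) := by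
  simp only [gQt, fold3, Matrix.add_mul, Matrix.smul_mul, Matrix.mul_assoc,
    kronecker_one_mul_unfold3, Matrix.add_apply, Matrix.smul_apply, circ_mul_unfold3_apply,
    smul_eq_mul, Finset.sum_add_distrib, Finset.mul_sum]

theorem conjT_apply {n₁ n₂ n₃ : ℕ} (μ : Quaternion ℝ) (A : QTensor n₁ n₂ n₃) (q : Fin n₂)
    (p : Fin n₁) (l : Fin n₃) :
    conjT μ A q p l = compE A p q (revIdx l)
      - (∑ s, (Tm (mui μ) μ n₃)ᴴ l s * compI A p q (revIdx s)) * qi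
      - (∑ s, (Tm (muj μ) μ n₃)ᴴ l s * compJ A p q (revIdx s)) * qj
      - (∑ s, (Tm (muk μ) μ n₃)ᴴ l s * compK A p q (revIdx s)) * qk := by
  simp only [conjT, fold3, kronecker_one_mul_unfold3, rmulM, Matrix.sub_apply]
  rfl

theorem qi_components : qi.re = 0 ∧ qi.imI = 1 ∧ qi.imJ = 0 ∧ qi.imK = 0 :=
  ⟨rfl, rfl, rfl, rfl⟩

theorem qj_components : qj.re = 0 ∧ qj.imI = 0 ∧ qj.imJ = 1 ∧ qj.imK = 0 :=
  ⟨rfl, rfl, rfl, rfl⟩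

theorem qk_components : qk.re = 0 ∧ qk.imI = 0 ∧ qk.imJ = 0 ∧ qk.imK = 1 :=
  ⟨rfl, rfl, rfl, rfl⟩

theorem mui_components (μ : Quaternion ℝ) : (mui μ).re = 0 ∧ (mui μ).imI = μ.imI ∧
    (mui μ).imJ = -μ.imJ ∧ (mui μ).imK = -μ.imK :=
  ⟨rfl, rfl, rfl, rfl⟩

theorem muj_components (μ : Quaternion ℝ) : (muj μ).re = 0 ∧ (muj μ).imI = -μ.imI ∧
    (muj μ).imJ = μ.imJ ∧ (muj μ).imK = -μ.imK :=
  ⟨rfl, rfl, rfl, rfl⟩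

theorem muk_components (μ : Quaternion ℝ) : (muk μ).re = 0 ∧ (muk μ).imI = -μ.imI ∧
    (muk μ).imJ = -μ.imJ ∧ (muk μ).imK = μ.imK :=
  ⟨rfl, rfl, rfl, rfl⟩

theorem comp_decomp {a b c : ℕ} (A : QTensor a b c) (p : Fin a) (q : Fin b) (l : Fin c) :
    A p q l = compE A p q l + qi * compI A p q l + qj * compJ A p q l + qk * compK A p q l := by
  ext <;> simp [compE, compI, compJ, compK, qi_components, qj_components, qk_components]

theorem UnitPure.star_eq_neg {μ : Quaternion ℝ} (hμ : UnitPure μ) : star μ = -μ :=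
  Quaternion.star_eq_neg.2 hμ.1

theorem UnitPure.mul_self {μ : Quaternion ℝ} (hμ : UnitPure μ) : μ * μ = -1 := by
  have h := Quaternion.self_mul_star μ
  rw [hμ.star_eq_neg, Quaternion.normSq_eq_norm_mul_self, hμ.2, mul_neg, mul_one,
    Quaternion.coe_one] at h
  rw [← h, neg_neg]

theorem UnitPure.of_sq_eq {μ ν : Quaternion ℝ} (hμ : UnitPure μ) (h0 : ν.re = 0)
    (hI : ν.imI ^ 2 = μ.imI ^ 2) (hJ : ν.imJ ^ 2 = μ.imJ ^ 2) (hK : ν.imK ^ 2 = μ.imK ^ 2) :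
    UnitPure ν := by
  refine ⟨h0, ?_⟩
  have h : Quaternion.normSq ν = Quaternion.normSq μ := by
    rw [Quaternion.normSq_def', Quaternion.normSq_def', h0, hμ.1, hI, hJ, hK]
  rw [Quaternion.normSq_eq_norm_mul_self, Quaternion.normSq_eq_norm_mul_self] at h
  rw [← hμ.2]
  exact (mul_self_inj (norm_nonneg _) (norm_nonneg _)).1 h

theorem UnitPure.mui {μ : Quaternion ℝ} (hμ : UnitPure μ) : UnitPure (mui μ) :=
  hμ.of_sq_eq rfl (by simp [mui_components]) (by simp [mui_components])
    (by simp [mui_components])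

theorem UnitPure.muj {μ : Quaternion ℝ} (hμ : UnitPure μ) : UnitPure (muj μ) :=
  hμ.of_sq_eq rfl (by simp [muj_components]) (by simp [muj_components])
    (by simp [muj_components])

theorem UnitPure.muk {μ : Quaternion ℝ} (hμ : UnitPure μ) : UnitPure (muk μ) :=
  hμ.of_sq_eq rfl (by simp [muk_components]) (by simp [muk_components])
    (by simp [muk_components])

theorem UnitPure.mul_qi {μ : Quaternion ℝ} (hμ : UnitPure μ) : μ * qi = qi * QTpaper.mui μ := by
  ext <;> simp [qi_components, mui_components, hμ.1]

theorem UnitPure.mul_qj {μ : Quaternion ℝ} (hμ : UnitPure μ) : μ * qj = qj * QTpaper.muj μ := by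
  ext <;> simp [qj_components, muj_components, hμ.1]

theorem UnitPure.mul_qk {μ : Quaternion ℝ} (hμ : UnitPure μ) : μ * qk = qk * QTpaper.muk μ := by
  ext <;> simp [qk_components, muk_components, hμ.1]

theorem star_qi : star qi = -qi := Quaternion.star_eq_neg.2 rfl

theorem star_qj : star qj = -qj := Quaternion.star_eq_neg.2 rfl

theorem star_qk : star qk = -qk := Quaternion.star_eq_neg.2 rfl

theorem sum_Fq_mul_eq {a b c : ℕ} (μ : Quaternion ℝ) (A : QTensor a b c) (p : Fin a) (q : Fin b)
    (k : Fin c) :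
    ∑ l, Fq μ c k l * A p q l = ∑ l, Fq μ c k l * compE A p q l
      + ∑ l, Fq μ c k l * (qi * compI A p q l) + ∑ l, Fq μ c k l * (qj * compJ A p q l)
      + ∑ l, Fq μ c k l * (qk * compK A p q l) := by
  simp only [← Finset.sum_add_distrib, ← mul_add, ← comp_decomp]

theorem fslice_fftT_gQt {n₁ r n₂ n₃ : ℕ} {μ : Quaternion ℝ} (hμ : UnitPure μ)
    (A : QTensor n₁ r n₃) (B : QTensor r n₂ n₃) (k : Fin n₃) :
    fslice (fftT μ (gQt μ A B)) k = fslice (fftT μ A) k * fslice (fftT μ B) k := by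
  ext1 p q
  simp only [fslice, fftT, Matrix.mul_apply, gQt_apply, Quaternion.coe_mul_eq_smul]
  simp only [Finset.mul_sum (s := (Finset.univ : Finset (Fin r)))]
  rw [Finset.sum_comm, Finset.smul_sum]
  refine Finset.sum_congr rfl fun t _ => ?_
  simp only [mul_add, Finset.sum_add_distrib]
  rw [sum_Fq_mul_eq μ A]
  have hE := sum_Fq_conv hμ.mul_self k (fun l => (A p t l).re) (B t q)
  have hI := sum_Fq_conv_Tm hμ.mul_qi hμ.mui.mul_self hμ.mui.star_eq_neg k
    (fun l => (A p t l).imI) (B t q)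
  have hJ := sum_Fq_conv_Tm hμ.mul_qj hμ.muj.mul_self hμ.muj.star_eq_neg k
    (fun l => (A p t l).imJ) (B t q)
  have hK := sum_Fq_conv_Tm hμ.mul_qk hμ.muk.mul_self hμ.muk.star_eq_neg k
    (fun l => (A p t l).imK) (B t q)
  simp only [compE, compI, compJ, compK]
  rw [hE, hI, hJ, hK]
  simp only [add_mul, smul_add, smul_mul_assoc, mul_smul_comm]

theorem fslice_fftT_conjT {n₁ n₂ n₃ : ℕ} {μ : Quaternion ℝ} (hμ : UnitPure μ)
    (A : QTensor n₁ n₂ n₃) (k : Fin n₃) :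
    fslice (fftT μ (conjT μ A)) k = (fslice (fftT μ A) k)ᴴ := by
  ext1 q p
  rw [Matrix.conjTranspose_apply]
  simp only [fslice, fftT, conjT_apply, Quaternion.coe_mul_eq_smul,
    Quaternion.star_smul]
  simp only [mul_sub, Finset.sum_sub_distrib]
  rw [sum_Fq_mul_eq μ A]
  have hE := sum_Fq_rev hμ.mul_self hμ.star_eq_neg k (fun l => (A p q l).re)
  have hI := sum_Fq_conj_Tm hμ.mul_qi hμ.mul_self hμ.star_eq_neg hμ.mui.mul_self
    hμ.mui.star_eq_neg star_qi k (fun l => (A p q l).imI)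
  have hJ := sum_Fq_conj_Tm hμ.mul_qj hμ.mul_self hμ.star_eq_neg hμ.muj.mul_self
    hμ.muj.star_eq_neg star_qj k (fun l => (A p q l).imJ)
  have hK := sum_Fq_conj_Tm hμ.mul_qk hμ.mul_self hμ.star_eq_neg hμ.muk.mul_self
    hμ.muk.star_eq_neg star_qk k (fun l => (A p q l).imK)
  simp only [compE, compI, compJ, compK]
  rw [hE, hI, hJ, hK]
  simp only [star_add, sub_neg_eq_add]

theorem fftT_injective {a b c : ℕ} {μ : Quaternion ℝ} (hμ : UnitPure μ) :
    Function.Injective (fftT (a := a) (b := b) (c := c) μ) := by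
  intro A B hAB
  ext1 p
  ext1 q
  rcases Nat.eq_zero_or_pos c with rfl | hc
  · exact Subsingleton.elim _ _
  have : NeZero c := ⟨hc.ne'⟩
  have hF : Fq μ c *ᵥ A p q = Fq μ c *ᵥ B p q := by
    ext1 l
    have h := congrFun (congrFun (congrFun hAB p) q) l
    simp only [fftT, Quaternion.coe_mul_eq_smul] at h
    exact smul_right_injective _ (Real.sqrt_pos.2 (Nat.cast_pos.2 hc)).ne' h
  have h := congrArg ((Fq μ c)ᴴ *ᵥ ·) hF
  simpa [Matrix.mulVec_mulVec, conjTranspose_mul_Fq hμ.mul_self hμ.star_eq_neg] using h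

theorem fslice_fftT_idT (μ : Quaternion ℝ) (n : ℕ) {c : ℕ} (k : Fin c) :
    fslice (fftT μ (idT n c)) k = 1 := by
  have : NeZero c := ⟨by have := k.2; omega⟩
  have hc : Real.sqrt c ≠ 0 := (Real.sqrt_pos.2 (Nat.cast_pos.2 (NeZero.pos c))).ne'
  ext1 p q
  simp only [fslice, fftT, idT, Quaternion.coe_mul_eq_smul, Matrix.one_apply]
  rw [Finset.sum_eq_single 0]
  · by_cases h : p = q
    · simp only [h, Fq, Fin.val_zero, and_self, if_true]
      rw [← Quaternion.coe_mul_eq_smul]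
      simp only [Nat.cast_zero, mul_zero, zero_div, Real.cos_zero, Real.sin_zero, Quaternion.coe_one,
        Quaternion.coe_zero, zero_mul, sub_zero, mul_one]
      rw [← Quaternion.coe_mul, mul_one_div_cancel hc, Quaternion.coe_one]
    · simp [h]
  · intro m _ hm
    have : m.1 ≠ 0 := fun h => hm (Fin.ext h)
    simp [this]
  · simp

theorem eq_idT_iff {μ : Quaternion ℝ} (hμ : UnitPure μ) {n c : ℕ} (A : QTensor n n c) :
    A = idT n c ↔ ∀ l, fslice (fftT μ A) l = 1 := by
  refine ⟨fun h l => h ▸ fslice_fftT_idT μ n l, fun h => fftT_injective hμ ?_⟩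
  ext1 p
  ext1 q
  ext1 l
  exact congrFun (congrFun ((h l).trans (fslice_fftT_idT μ n l).symm) p) q

/-- a tensor is unitary iff each frontal slice of its QDFT is unitary. -/
theorem unitaryT_iff_fft_slices_unitary {n n₃ : ℕ} (μ : Quaternion ℝ) (hμ : UnitPure μ)
    (U : QTensor n n n₃) :
    unitaryT μ U ↔
      ∀ l : Fin n₃,
        fslice (fftT μ U) l * (fslice (fftT μ U) l)ᴴ = 1 ∧
        (fslice (fftT μ U) l)ᴴ * fslice (fftT μ U) l = 1 := by
  simp only [unitaryT, eq_idT_iff hμ, fslice_fftT_gQt hμ, fslice_fftT_conjT hμ, ← forall_and]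
  exact forall_congr' fun _ => and_comm


end QTpaper
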